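/- Let K ≥ 1, and for each k ∈ {1,…,K} let p_d(·|k) and p_G(·|k) be probability mass functions on a finite set Y, with p(k) = 1/K. Consider classifiers A assigning to each y ∈ Y a probability vector (p_A(1|y),…,p_A(2K|y)) summing to 1. Then the loss L(A) = −(1/K)Σ_k Σ_y p_d(y|k) log p_A(k|y) − (1/K)Σ_k Σ_y p_G(y|k) log p_A(K+k|y) is minimized by p_A*(k|y) = p(k)p_d(y|k)/Z(y) for 1 ≤ k ≤ K and p_A*(K+k|y) = p(k)p_G(y|k)/Z(y), where Z(y) = Σ_k p(k)p_d(y|k) + Σ_k p(k)p_G(y|k), whenever Z(y) > 0 for all y. -/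

import Mathlib

/-- The termwise Gibbs inequality for unnormalised weights, from `log x ≤ x - 1`. -/
theorem mul_mul_log_le_add_sub {c p a Z : ℝ} (hc : 0 < c) (hp : 0 ≤ p) (ha : 0 ≤ a) (hZ : 0 < Z)
    (hpa : 0 < p → 0 < a) :
    c * (p * Real.log a) ≤ c * (p * Real.log (c * p / Z)) + (Z * a - c * p) := by
  rcases hp.eq_or_lt with rfl | hp
  · simpa using mul_nonneg hZ.le ha
  · have ha := hpa hp
    have hq : 0 < c * p / Z := by positivity
    have hlog := Real.log_le_sub_one_of_pos (div_pos ha hq)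
    rw [Real.log_div ha.ne' hq.ne'] at hlog
    have hmul := mul_le_mul_of_nonneg_left hlog (mul_pos hc hp).le
    have hcancel : c * p * (a / (c * p / Z) - 1) = Z * a - c * p := by
      field_simp
    linarith


/-- Optimal augmented classifier in A-StarGAN: with `2K` classes (`K` real, `K` fake),
the cross-entropy loss is minimized by the normalized weighted densities. -/
theorem optimal_augmented_classifier {Y : Type*} [Fintype Y] (K : ℕ) (hK : 1 ≤ K)
    (pd pG : Fin K → Y → ℝ)
    (hpd0 : ∀ k y, 0 ≤ pd k y) (hpd1 : ∀ k, ∑ y, pd k y = 1)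
    (hpG0 : ∀ k y, 0 ≤ pG k y) (hpG1 : ∀ k, ∑ y, pG k y = 1)
    (Z : Y → ℝ)
    (hZ : ∀ y, Z y = (∑ k, (1 / (K : ℝ)) * pd k y) + ∑ k, (1 / (K : ℝ)) * pG k y)
    (hZpos : ∀ y, 0 < Z y)
    (Areal Afake : Y → Fin K → ℝ)
    (hA0 : ∀ y k, 0 ≤ Areal y k) (hA0' : ∀ y k, 0 ≤ Afake y k)
    (hAsum : ∀ y, (∑ k, Areal y k) + ∑ k, Afake y k = 1)
    (hApos : ∀ y k, 0 < pd k y → 0 < Areal y k)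
    (hApos' : ∀ y k, 0 < pG k y → 0 < Afake y k) :
    (-(1 / (K : ℝ)) * ∑ k, ∑ y, pd k y * Real.log ((1 / (K : ℝ)) * pd k y / Z y)
      - (1 / (K : ℝ)) * ∑ k, ∑ y, pG k y * Real.log ((1 / (K : ℝ)) * pG k y / Z y))
    ≤ -(1 / (K : ℝ)) * ∑ k, ∑ y, pd k y * Real.log (Areal y k)
      - (1 / (K : ℝ)) * ∑ k, ∑ y, pG k y * Real.log (Afake y k) := by
  have hc : (0 : ℝ) < 1 / (K : ℝ) := by
    have : (0 : ℝ) < K := by exact_mod_cast hK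
    positivity
  generalize 1 / (K : ℝ) = c at *
  have hreal := Finset.sum_le_sum fun k (_ : k ∈ Finset.univ) =>
    Finset.sum_le_sum fun y (_ : y ∈ Finset.univ) =>
      mul_mul_log_le_add_sub hc (hpd0 k y) (hA0 y k) (hZpos y) (hApos y k)
  have hfake := Finset.sum_le_sum fun k (_ : k ∈ Finset.univ) =>
    Finset.sum_le_sum fun y (_ : y ∈ Finset.univ) =>
      mul_mul_log_le_add_sub hc (hpG0 k y) (hA0' y k) (hZpos y) (hApos' y k)
  have hslack : (∑ k, ∑ y, (Z y * Areal y k - c * pd k y))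
      + ∑ k, ∑ y, (Z y * Afake y k - c * pG k y) = 0 := by
    rw [Finset.sum_comm, Finset.sum_comm (f := fun k y => Z y * Afake y k - c * pG k y),
      ← Finset.sum_add_distrib]
    refine Finset.sum_eq_zero fun y _ => ?_
    simp only [Finset.sum_sub_distrib, ← Finset.mul_sum] at hZ ⊢
    linear_combination Z y * hAsum y + hZ y
  simp only [Finset.sum_add_distrib, ← Finset.mul_sum] at hreal hfake
  linarith
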